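/- Let n ≥ 1, let A ⊆ ℤ^n be a finite nonempty set, and let P = conv(A) ⊆ ℝ^n be its convex hull. For each integer k ≥ 0 let E_P(k) be the number of points of ℤ^n lying in the dilate kP = {k·p : p ∈ P}. Then there exists a polynomial p with rational coefficients, of degree at most n, such that E_P(k) = p(k) for all integers k ≥ 0. -/

import Mathlib

open Classical in
lemma eu_one {σ : Type} (s : Finset σ) (α : σ → ℤ) (J : σ → Set ℝ)
    (hc : ∀ i ∈ s, IsCompact (J i)) (hv : ∀ i ∈ s, Convex ℝ (J i))
    (h : ∀ t, ∑ i ∈ s, (if t ∈ J i then α i else 0) = 0) :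
    ∑ i ∈ s, (if (J i).Nonempty then α i else 0) = 0 := by
  have key : ∀ t, ∑ i ∈ s with sSup (J i) = t, (if (J i).Nonempty then α i else 0) = 0 := by
    intro t
    have ev : ∀ᶠ u in nhdsWithin t (Set.Ioi t), ∀ i ∈ s,
        (u ∈ J i ↔ (t ∈ J i ∧ sSup (J i) ≠ t)) := by
      rw [Filter.eventually_all_finset]
      intro i hi
      by_cases ht : t ∈ J i
      · by_cases hs : sSup (J i) = t
        · filter_upwards [self_mem_nhdsWithin] with u hu
          simp only [hs, ne_eq, not_true_eq_false, and_false, iff_false]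
          intro hu'
          have := le_csSup (hc i hi).bddAbove hu'
          rw [hs] at this
          exact absurd hu (not_lt.mpr this)
        · have hlt : t < sSup (J i) :=
            lt_of_le_of_ne (le_csSup (hc i hi).bddAbove ht) (Ne.symm hs)
          filter_upwards [Ioo_mem_nhdsGT hlt] with u hu
          simp only [ht, ne_eq, hs, not_false_eq_true, and_self, iff_true]
          exact (hv i hi).ordConnected.out ht ((hc i hi).sSup_mem ⟨t, ht⟩) ⟨hu.1.le, hu.2.le⟩
      · have : ∀ᶠ u in nhdsWithin t (Set.Ioi t), u ∈ (J i)ᶜ :=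
          nhdsWithin_le_nhds ((hc i hi).isClosed.isOpen_compl.mem_nhds ht)
        filter_upwards [this] with u hu
        simp only [ht, false_and, iff_false]
        exact hu
    obtain ⟨u, hu⟩ := ev.exists
    have h1 := h t
    have h2 := h u
    rw [Finset.sum_filter]
    have : ∑ i ∈ s, (if sSup (J i) = t then (if (J i).Nonempty then α i else 0) else 0)
      = ∑ i ∈ s, ((if t ∈ J i then α i else 0) - (if u ∈ J i then α i else 0)) := by
      apply Finset.sum_congr rfl
      intro i hi
      rw [if_congr (hu i hi) rfl rfl]
      by_cases hs : sSup (J i) = t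
      · by_cases hn : (J i).Nonempty
        · have : t ∈ J i := hs ▸ (hc i hi).sSup_mem hn
          simp [hs, hn, this]
        · have : t ∉ J i := fun h => hn ⟨t, h⟩
          simp [hs, hn, this]
      · simp [hs]
    rw [this, Finset.sum_sub_distrib, h1, h2, sub_zero]
  rw [← Finset.sum_fiberwise_of_maps_to (t := s.image fun i => sSup (J i))
    (g := fun i => sSup (J i)) (fun i hi => Finset.mem_image_of_mem _ hi)]
  exact Finset.sum_eq_zero fun t _ => key t

open Classical in
lemma eu_all (d : ℕ) {σ : Type} (s : Finset σ) (α : σ → ℤ) : ∀ (K : σ → Set (Fin d → ℝ))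
    (_ : ∀ i ∈ s, IsCompact (K i)) (_ : ∀ i ∈ s, Convex ℝ (K i))
    (_ : ∀ t, ∑ i ∈ s, (if t ∈ K i then α i else 0) = 0),
    ∑ i ∈ s, (if (K i).Nonempty then α i else 0) = 0 := by
  induction d with
  | zero =>
    intro K _ _ h
    refine Eq.trans ?_ (h 0)
    apply Finset.sum_congr rfl
    intro i _
    refine if_congr ⟨?_, fun h => ⟨_, h⟩⟩ rfl rfl
    rintro ⟨x, hx⟩
    rwa [Subsingleton.elim x 0] at hx
  | succ d ih =>
    intro K hc hv h
    have hJ := eu_one s α (fun i => (fun x : Fin (d+1) → ℝ => x 0) '' K i)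
      (fun i hi => (hc i hi).image (by fun_prop))
      (fun i hi => (hv i hi).linear_image (LinearMap.proj (R := ℝ) (φ := fun _ => ℝ) (0 : Fin (d+1))))
      ?_
    · simpa only [Set.image_nonempty] using hJ
    · intro t
      have e : ∀ i, t ∈ (fun x : Fin (d+1) → ℝ => x 0) '' K i ↔
          {y : Fin d → ℝ | (Fin.cons t y : Fin (d+1) → ℝ) ∈ K i}.Nonempty := by
        intro i
        constructor
        · rintro ⟨x, hx, rfl⟩
          exact ⟨Fin.tail x, by simpa using hx⟩
        · rintro ⟨y, hy⟩
          exact ⟨_, hy, by simp⟩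
      simp only [e]
      apply ih
      · intro i hi
        have hcl : IsClosed {y : Fin d → ℝ | (Fin.cons t y : Fin (d+1) → ℝ) ∈ K i} :=
          (hc i hi).isClosed.preimage (by fun_prop)
        have := (hc i hi).image (f := fun x : Fin (d+1) → ℝ => (Fin.tail x : Fin d → ℝ))
          (by unfold Fin.tail; fun_prop)
        refine this.of_isClosed_subset hcl ?_
        intro y hy
        exact ⟨_, hy, by simp⟩
      · intro i hi x hx y hy a b ha hb hab
        have := hv i hi hx hy ha hb hab
        simp only [Set.mem_ofPred_eq]
        convert this using 1
        ext j
        refine Fin.cases ?_ (fun j => ?_) j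
        · simp [← add_mul, hab]
        · simp
      · intro y
        exact h (Fin.cons t y)

/-- weight vectors -/
def WF {m n : ℕ} (v : Fin m → Fin n → ℤ) (T : Finset (Fin m)) (k : ℕ) (x : Fin n → ℤ) :
    Set (Fin m → ℝ) :=
  {c | (∀ i, 0 ≤ c i) ∧ (∀ i, i ∉ T → c i = 0) ∧ ∑ i, c i = k ∧
    ∀ j, ∑ i, c i * (v i j : ℝ) = x j}

lemma WF_compact {m n : ℕ} (v : Fin m → Fin n → ℤ) (T : Finset (Fin m)) (k : ℕ) (x : Fin n → ℤ) :
    IsCompact (WF v T k x) := by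
  refine (isCompact_Icc (a := (0 : Fin m → ℝ)) (b := fun _ => (k : ℝ))).of_isClosed_subset ?_ ?_
  · unfold WF
    simp only [Set.ofPred_and, Set.ofPred_forall]
    refine IsClosed.inter ?_ (IsClosed.inter ?_ (IsClosed.inter ?_ ?_))
    · exact isClosed_iInter fun i => isClosed_le (by fun_prop) (by fun_prop)
    · exact isClosed_iInter fun i => isClosed_iInter fun _ => isClosed_eq (by fun_prop) (by fun_prop)
    · exact isClosed_eq (by fun_prop) (by fun_prop)
    · exact isClosed_iInter fun i => isClosed_eq (by fun_prop) (by fun_prop)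
  · rintro c ⟨h1, h2, h3, h4⟩
    refine ⟨h1, fun i => ?_⟩
    rw [← h3]
    exact Finset.single_le_sum (fun i _ => h1 i) (Finset.mem_univ i)

lemma WF_convex {m n : ℕ} (v : Fin m → Fin n → ℤ) (T : Finset (Fin m)) (k : ℕ) (x : Fin n → ℤ) :
    Convex ℝ (WF v T k x) := by
  rintro c ⟨h1, h2, h3, h4⟩ c' ⟨h1', h2', h3', h4'⟩ a b ha hb hab
  refine ⟨fun i => ?_, fun i hi => ?_, ?_, fun j => ?_⟩
  · have := h1 i; have := h1' i
    simp only [Pi.add_apply, Pi.smul_apply, smul_eq_mul]; positivity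
  · simp [h2 i hi, h2' i hi]
  · simp only [Pi.add_apply, Pi.smul_apply, smul_eq_mul, Finset.sum_add_distrib,
      ← Finset.mul_sum, h3, h3', ← add_mul, hab, one_mul]
  · simp only [Pi.add_apply, Pi.smul_apply, smul_eq_mul, add_mul, Finset.sum_add_distrib,
      mul_assoc, ← Finset.mul_sum, h4, h4']
    simp only [← add_mul, hab, one_mul]

/-- no affine dependence supported on T -/
def Indep {m n : ℕ} (v : Fin m → Fin n → ℤ) (T : Finset (Fin m)) : Prop :=
  ∀ w : Fin m → ℝ, (∀ i, i ∉ T → w i = 0) → ∑ i, w i = 0 →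
    (∀ j, ∑ i, w i * (v i j : ℝ) = 0) → w = 0

open Classical in
lemma WF_alt {m n : ℕ} (v : Fin m → Fin n → ℤ) (T : Finset (Fin m)) (k : ℕ) (x : Fin n → ℤ)
    (w : Fin m → ℝ) (hw1 : ∀ i, i ∉ T → w i = 0) (hw2 : ∑ i, w i = 0)
    (hw3 : ∀ j, ∑ i, w i * (v i j : ℝ) = 0) (I : Finset (Fin m)) (hI : ∀ i, i ∈ I ↔ 0 < w i)
    (i0 : Fin m) (hi0 : i0 ∈ I) :
    ∑ S ∈ I.powerset, (if (WF v (T \ S) k x).Nonempty then ((-1 : ℤ) ^ S.card) else 0) = 0 := by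
  have hi0' := (hI i0).1 hi0
  let ρ : (Fin m → ℝ) → (Fin m → ℝ) := fun c => c - (c i0 / w i0) • w
  have main := eu_all m I.powerset (fun S => (-1 : ℤ) ^ S.card) (fun S => ρ '' (WF v (T \ S) k x))
    (fun S _ => (WF_compact v _ k x).image (by fun_prop))
    (fun S _ => (WF_convex v _ k x).is_linear_image
      ⟨fun a b => by ext i; simp [ρ]; ring, fun a b => by ext i; simp [ρ]; ring⟩) ?_
  · simpa only [Set.image_nonempty] using main
  intro y
  by_cases hy : ∃ S ∈ I.powerset, y ∈ ρ '' WF v (T \ S) k x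
  swap
  · push Not at hy
    exact Finset.sum_eq_zero fun S hS => if_neg (hy S hS)
  obtain ⟨S0, hS0, c, ⟨hc1, hc2, hc3, hc4⟩, rfl⟩ := hy
  obtain ⟨i1, hi1, hmin⟩ := Finset.exists_min_image I (fun i => c i / w i) ⟨i0, hi0⟩
  have hi1' := (hI i1).1 hi1
  set t := c i1 / w i1 with ht
  have ht0 : 0 ≤ t := div_nonneg (hc1 _) hi1'.le
  set b : Fin m → ℝ := c - t • w with hb
  have hbn : ∀ i, 0 ≤ b i := by
    intro i
    simp only [hb, Pi.sub_apply, Pi.smul_apply, smul_eq_mul]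
    by_cases hi : i ∈ I
    · have := hmin i hi
      rw [le_div_iff₀ ((hI i).1 hi)] at this
      linarith
    · have h1 : w i ≤ 0 := not_lt.1 fun h => hi ((hI i).2 h)
      have := hc1 i
      nlinarith
  have hb1 : b i1 = 0 := by
    simp [hb, ht, hi1'.ne']
  have hρ : ρ b = ρ c := by
    ext i
    simp only [ρ, hb, Pi.sub_apply, Pi.smul_apply, smul_eq_mul]
    field_simp
    ring
  have e : ∀ S ∈ I.powerset, (ρ c ∈ ρ '' WF v (T \ S) k x ↔ S ⊆ I.filter (fun i => b i = 0)) := by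
    intro S hS
    rw [Finset.mem_powerset] at hS
    constructor
    · rintro ⟨c', ⟨hc1', hc2', hc3', hc4'⟩, he⟩ i hi
      rw [Finset.mem_filter]
      refine ⟨hS hi, ?_⟩
      have hi' := (hI i).1 (hS hi)
      have h0 : c' i = 0 := hc2' i (by simp [hi])
      rw [← hρ] at he
      -- c' = b + u w
      have hu : ∀ l, c' l = b l + (c' i0 / w i0 - b i0 / w i0) * w l := by
        intro l
        have := congrFun he l
        simp only [ρ, Pi.sub_apply, Pi.smul_apply, smul_eq_mul] at this
        linarith
      generalize c' i0 / w i0 - b i0 / w i0 = u at hu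
      have hh1 := hu i1
      rw [hb1, zero_add] at hh1
      have hu0 : 0 ≤ u := by
        by_contra hneg
        push Not at hneg
        have := hc1' i1
        nlinarith
      have hh2 := hu i
      have := hbn i
      have : 0 ≤ u * w i := by positivity
      linarith
    · intro hSS
      refine ⟨b, ⟨hbn, ?_, ?_, ?_⟩, hρ⟩
      · intro i hi
        by_cases hiS : i ∈ S
        · exact (Finset.mem_filter.1 (hSS hiS)).2
        · have hiT : i ∉ T := fun h => hi (Finset.mem_sdiff.2 ⟨h, hiS⟩)
          have : c i = 0 := hc2 i (by simp [hiT])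
          simp [hb, this, hw1 i hiT]
      · simp [hb, Finset.sum_sub_distrib, ← Finset.mul_sum, hw2, hc3]
      · intro j
        simp [hb, sub_mul, mul_assoc, Finset.sum_sub_distrib, ← Finset.mul_sum, hw3, hc4]
  rw [Finset.sum_congr rfl fun S hS => if_congr (e S hS) rfl rfl, ← Finset.sum_filter]
  have : I.powerset.filter (fun S => S ⊆ I.filter (fun i => b i = 0))
      = (I.filter (fun i => b i = 0)).powerset := by
    ext S
    simp only [Finset.mem_filter, Finset.mem_powerset]
    exact ⟨fun h => h.2, fun h => ⟨h.trans (Finset.filter_subset _ _), h⟩⟩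
  rw [this, Finset.sum_powerset_neg_one_pow_card, if_neg]
  exact Finset.ne_empty_of_mem (Finset.mem_filter.2 ⟨hi1, hb1⟩)

/-- lattice points -/
def LP {m n : ℕ} (v : Fin m → Fin n → ℤ) (T : Finset (Fin m)) (k : ℕ) : Set (Fin n → ℤ) :=
  {x | (WF v T k x).Nonempty}

lemma LP_finite {m n : ℕ} (v : Fin m → Fin n → ℤ) (T : Finset (Fin m)) (k : ℕ) :
    (LP v T k).Finite := by
  refine (Set.finite_Icc (fun j => -∑ i, (k : ℤ) * |v i j|) (fun j => ∑ i, (k : ℤ) * |v i j|)).subset ?_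
  rintro x ⟨c, h1, h2, h3, h4⟩
  have hck : ∀ i, c i ≤ k := fun i => by
    rw [← h3]
    exact Finset.single_le_sum (fun i _ => h1 i) (Finset.mem_univ i)
  have : ∀ j, |x j| ≤ ∑ i, (k : ℤ) * |v i j| := by
    intro j
    have h : |(x j : ℝ)| ≤ ∑ i, (k : ℝ) * |(v i j : ℝ)| := by
      rw [← h4 j]
      refine (Finset.abs_sum_le_sum_abs _ _).trans (Finset.sum_le_sum fun i _ => ?_)
      rw [abs_mul, abs_of_nonneg (h1 i)]
      exact mul_le_mul_of_nonneg_right (hck i) (abs_nonneg _)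
    exact_mod_cast h
  exact ⟨fun j => (abs_le.1 (this j)).1, fun j => (abs_le.1 (this j)).2⟩

lemma WF_unique {m n : ℕ} {v : Fin m → Fin n → ℤ} {T : Finset (Fin m)} (hT : Indep v T) {k : ℕ}
    {x : Fin n → ℤ} {c c' : Fin m → ℝ} (hc : c ∈ WF v T k x) (hc' : c' ∈ WF v T k x) : c = c' := by
  obtain ⟨h1, h2, h3, h4⟩ := hc
  obtain ⟨h1', h2', h3', h4'⟩ := hc'
  have := hT (c - c') (fun i hi => by simp [h2 i hi, h2' i hi])
    (by simp [Finset.sum_sub_distrib, h3, h3'])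
    (fun j => by simp [sub_mul, Finset.sum_sub_distrib, h4, h4'])
  exact sub_eq_zero.1 this

/-- box -/
def BX {m n : ℕ} (v : Fin m → Fin n → ℤ) (T : Finset (Fin m)) : Set (Fin m → ℝ) :=
  {r | (∀ i, r i < 1) ∧ ∃ h x, r ∈ WF v T h x}

lemma BX_lt {m n : ℕ} {v : Fin m → Fin n → ℤ} {T : Finset (Fin m)} (hne : T.Nonempty)
    {r : Fin m → ℝ} (hr : ∀ i, r i < 1) {h : ℕ} {x : Fin n → ℤ} (hx : r ∈ WF v T h x) :
    h < T.card := by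
  obtain ⟨h1, h2, h3, h4⟩ := hx
  have : ∑ i ∈ T, r i = h := by
    rw [← h3]
    exact Finset.sum_subset (Finset.subset_univ _) fun i _ hi => h2 i hi
  have h5 : ∑ i ∈ T, r i < ∑ i ∈ T, (1 : ℝ) := Finset.sum_lt_sum_of_nonempty hne fun i _ => hr i
  rw [this] at h5
  simp only [Finset.sum_const, nsmul_eq_mul, mul_one] at h5
  exact_mod_cast h5

lemma BX_finite {m n : ℕ} {v : Fin m → Fin n → ℤ} {T : Finset (Fin m)} (hT : Indep v T)
    (hne : T.Nonempty) : (BX v T).Finite := by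
  have : (⋃ h ∈ Finset.range T.card, ⋃ x ∈ LP v T h, WF v T h x).Finite := by
    refine Set.Finite.biUnion (Finset.finite_toSet _) fun h _ =>
      Set.Finite.biUnion (LP_finite v T h) fun x _ => ?_
    exact Set.Subsingleton.finite fun a ha b hb => WF_unique hT ha hb
  refine this.subset ?_
  rintro r ⟨hr, h, x, hx⟩
  simp only [Set.mem_iUnion]
  exact ⟨h, Finset.mem_range.2 (BX_lt hne hr hx), x, ⟨r, hx⟩, hx⟩

lemma Indep_card {m n : ℕ} {v : Fin m → Fin n → ℤ} {T : Finset (Fin m)} (hT : Indep v T) :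
    T.card ≤ n + 1 := by
  classical
  let f : (T → ℝ) →ₗ[ℝ] ((Fin n → ℝ) × ℝ) :=
    { toFun := fun w => (fun j => ∑ i, w i * (v i j : ℝ), ∑ i, w i)
      map_add' := fun a b => by
        ext <;> simp [add_mul, Finset.sum_add_distrib]
      map_smul' := fun a b => by
        ext <;> simp [mul_assoc, Finset.mul_sum] }
  have hf : Function.Injective f := by
    rw [← LinearMap.ker_eq_bot, LinearMap.ker_eq_bot']
    intro w hw
    have hw1 : ∀ j, ∑ i, w i * (v i j : ℝ) = 0 := fun j => congrFun (congrArg Prod.fst hw) j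
    have hw2 : ∑ i, w i = 0 := congrArg Prod.snd hw
    have key : ∀ g : Fin m → ℝ, ∑ i, (if h : i ∈ T then w ⟨i, h⟩ else 0) * g i = ∑ i : T, w i * g i := by
      intro g
      rw [← Finset.sum_subset (Finset.subset_univ T) (fun i _ hi => by simp [hi]),
        ← Finset.sum_coe_sort T]
      exact Finset.sum_congr rfl fun i _ => by simp
    have := hT (fun i => if h : i ∈ T then w ⟨i, h⟩ else 0) (fun i hi => by simp [hi])
      (by have := key (fun _ => 1); simp only [mul_one] at this; rw [this, hw2]) (fun j => by rw [key, hw1])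
    ext i
    simpa using congrFun this i
  have := LinearMap.finrank_le_finrank_of_injective hf
  simpa using this

/-- binomial polynomial -/
lemma choose_poly (d e : ℕ) : ∃ p : Polynomial ℚ, p.natDegree ≤ d ∧
    ∀ k : ℕ, ((k + e).choose d : ℚ) = p.eval (k : ℚ) := by
  refine ⟨Polynomial.C ((d.factorial : ℚ)⁻¹) *
    (descPochhammer ℚ d).comp (Polynomial.X + Polynomial.C (e : ℚ)), ?_, ?_⟩
  · refine (Polynomial.natDegree_C_mul_le _ _).trans ?_
    refine Polynomial.natDegree_comp_le.trans ?_
    rw [descPochhammer_natDegree, Polynomial.natDegree_X_add_C, mul_one]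
  · intro k
    have := descPochhammer_eval_eq_descFactorial ℚ (k + e) d
    simp only [Polynomial.eval_mul, Polynomial.eval_C, Polynomial.eval_comp, Polynomial.eval_add,
      Polynomial.eval_X]
    rw [← Nat.cast_add, this, Nat.descFactorial_eq_factorial_mul_choose]
    have : (d.factorial : ℚ) ≠ 0 := by exact_mod_cast d.factorial_ne_zero
    push_cast
    field_simp

lemma antidiag_card {m : ℕ} (T : Finset (Fin m)) (k h : ℕ) (hh : h < T.card) :
    (if h ≤ k then T.finsuppAntidiag (k - h) else ∅).card
      = (k + (T.card - 1 - h)).choose (T.card - 1) := by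
  split_ifs with hk
  · rw [Finset.card_finsuppAntidiag_nat_eq_choose]
    have e : T.card + (k - h) - 1 = k + (T.card - 1 - h) := by omega
    rw [e]
    exact (Nat.choose_symm_of_eq_add (by omega))
  · rw [Finset.card_empty, Nat.choose_eq_zero_of_lt (by omega)]

open Classical in
lemma LP_card {m n : ℕ} {v : Fin m → Fin n → ℤ} {T : Finset (Fin m)} (hT : Indep v T)
    (hne : T.Nonempty) (k : ℕ) :
    (LP v T k).ncard = ∑ r ∈ (BX_finite hT hne).toFinset,
      (if ⌊∑ i, r i⌋₊ ≤ k then T.finsuppAntidiag (k - ⌊∑ i, r i⌋₊) else ∅).card := by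
  rw [← Finset.card_sigma]
  set Q := (BX_finite hT hne).toFinset.sigma fun r =>
    (if ⌊∑ i, r i⌋₊ ≤ k then T.finsuppAntidiag (k - ⌊∑ i, r i⌋₊) else ∅) with hQ
  let F : (Σ _ : Fin m → ℝ, Fin m →₀ ℕ) → (Fin n → ℤ) :=
    fun q j => ⌊∑ i, (q.1 i + q.2 i) * (v i j : ℝ)⌋
  have hF : ∀ q ∈ Q, (fun i => q.1 i + (q.2 i : ℝ)) ∈ WF v T k (F q) ∧
      ∀ i, 0 ≤ q.1 i ∧ q.1 i < 1 := by
    rintro ⟨r, a⟩ hq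
    rw [hQ, Finset.mem_sigma, Set.Finite.mem_toFinset] at hq
    obtain ⟨⟨hr, h, x, h1, h2, h3, h4⟩, ha⟩ := hq
    simp only [h3, Nat.floor_natCast] at ha
    split_ifs at ha with hk
    swap
    · simp at ha
    rw [Finset.mem_finsuppAntidiag] at ha
    obtain ⟨ha1, ha2⟩ := ha
    have ha0 : ∀ i, i ∉ T → a i = 0 := fun i hi => by
      by_contra h0
      exact hi (ha2 (Finsupp.mem_support_iff.2 h0))
    refine ⟨⟨fun i => add_nonneg (h1 i) (Nat.cast_nonneg _), fun i hi => by
      have := h2 i hi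
      simp only at this
      simp [this, ha0 i hi],
      ?_, fun j => ?_⟩, fun i => ⟨h1 i, hr i⟩⟩
    · have : ∑ i, a i = k - h := by
        rw [← ha1]
        exact (Finset.sum_subset (Finset.subset_univ _) fun i _ hi => ha0 i hi).symm
      rw [Finset.sum_add_distrib, h3, ← Nat.cast_sum, ← Nat.cast_add, this]
      congr 1
      omega
    · have : ∑ i, (r i + (a i : ℝ)) * (v i j : ℝ) = ((x j + ∑ i, (a i : ℤ) * v i j : ℤ) : ℝ) := by
        push_cast
        rw [← h4 j, ← Finset.sum_add_distrib]
        exact Finset.sum_congr rfl fun i _ => by ring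
      simp only [F, this, Int.floor_intCast]
  have himg : LP v T k = ((Q.image F : Finset _) : Set (Fin n → ℤ)) := by
    ext x
    simp only [Finset.coe_image, Set.mem_image, Finset.mem_coe]
    constructor
    · rintro ⟨c, hc1, hc2, hc3, hc4⟩
      have hfl : ∀ i, c i = Int.fract (c i) + (⌊c i⌋₊ : ℝ) := fun i => by
        rw [natCast_floor_eq_intCast_floor (hc1 i), Int.fract_add_floor]
      have hfs : ∑ i, ⌊c i⌋₊ ≤ k := by
        have : ((∑ i, ⌊c i⌋₊ : ℕ) : ℝ) ≤ k := by
          push_cast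
          rw [← hc3]
          exact Finset.sum_le_sum fun i _ => Nat.floor_le (hc1 i)
        exact_mod_cast this
      have hsum : ∑ i, Int.fract (c i) = ((k - ∑ i, ⌊c i⌋₊ : ℕ) : ℝ) := by
        rw [Nat.cast_sub hfs, ← hc3]
        push_cast
        rw [← Finset.sum_sub_distrib]
        exact Finset.sum_congr rfl fun i _ => by linarith [hfl i]
      refine ⟨⟨fun i => Int.fract (c i), Finsupp.equivFunOnFinite.symm fun i => ⌊c i⌋₊⟩, ?_, ?_⟩
      · rw [hQ, Finset.mem_sigma, Set.Finite.mem_toFinset]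
        refine ⟨⟨fun i => Int.fract_lt_one _, k - ∑ i, ⌊c i⌋₊,
          fun j => x j - ∑ i, (⌊c i⌋₊ : ℤ) * v i j, fun i => Int.fract_nonneg _,
          fun i hi => by simp [hc2 i hi], hsum, fun j => ?_⟩, ?_⟩
        · push_cast
          rw [← hc4 j, ← Finset.sum_sub_distrib]
          exact Finset.sum_congr rfl fun i _ => by
            have := hfl i
            rw [← sub_mul]
            congr 1
            linarith
        · simp only [hsum, Nat.floor_natCast]
          rw [if_pos (Nat.sub_le _ _), Finset.mem_finsuppAntidiag]
          have h0 : ∀ i, i ∉ T → ⌊c i⌋₊ = 0 := fun i hi => by simp [hc2 i hi]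
          constructor
          · have : ∑ i ∈ T, ⌊c i⌋₊ = ∑ i, ⌊c i⌋₊ :=
              Finset.sum_subset (Finset.subset_univ _) fun i _ hi => h0 i hi
            simp only [Finsupp.equivFunOnFinite_symm_apply_apply]
            omega
          · intro i hi
            by_contra hiT
            rw [Finsupp.mem_support_iff] at hi
            exact hi (h0 i hiT)
      · funext j
        simp only [F, Finsupp.equivFunOnFinite_symm_apply_apply, ← hfl, hc4 j, Int.floor_intCast]
    · rintro ⟨q, hq, rfl⟩
      exact ⟨_, (hF q hq).1⟩
  rw [himg, Set.ncard_coe_finset, Finset.card_image_of_injOn]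
  intro q hq q' hq' he
  obtain ⟨hw, hb⟩ := hF q hq
  obtain ⟨hw', hb'⟩ := hF q' hq'
  rw [← he] at hw'
  have hu := WF_unique hT hw hw'
  have h1 : ∀ i, q.1 i = q'.1 i := fun i => by
    have := congrArg Int.fract (congrFun hu i)
    simp only [Int.fract_add_natCast] at this
    rwa [Int.fract_eq_self.2 (hb i), Int.fract_eq_self.2 (hb' i)] at this
  have h2 : ∀ i, q.2 i = q'.2 i := fun i => by
    have := congrFun hu i
    simp only [h1 i, add_right_inj] at this
    exact_mod_cast this
  obtain ⟨r, a⟩ := q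
  obtain ⟨r', a'⟩ := q'
  obtain rfl : r = r' := funext h1
  obtain rfl : a = a' := Finsupp.ext h2
  rfl

lemma LP_poly_indep {m n : ℕ} {v : Fin m → Fin n → ℤ} {T : Finset (Fin m)} (hT : Indep v T)
    (hne : T.Nonempty) : ∃ p : Polynomial ℚ, p.natDegree ≤ n ∧
      ∀ k : ℕ, ((LP v T k).ncard : ℚ) = p.eval (k : ℚ) := by
  classical
  choose P hP1 hP2 using fun r : Fin m → ℝ =>
    choose_poly (T.card - 1) (T.card - 1 - ⌊∑ i, r i⌋₊)
  refine ⟨∑ r ∈ (BX_finite hT hne).toFinset, P r, ?_, fun k => ?_⟩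
  · refine Polynomial.natDegree_sum_le_of_forall_le _ _ fun r _ => (hP1 r).trans ?_
    have := Indep_card hT
    omega
  · rw [LP_card hT hne, Polynomial.eval_finsetSum, Nat.cast_sum]
    refine Finset.sum_congr rfl fun r hr => ?_
    rw [← hP2 r k]
    rw [Set.Finite.mem_toFinset] at hr
    obtain ⟨hr, h, x, hx⟩ := hr
    have hh := BX_lt hne hr hx
    have h3 := hx.2.2.1
    rw [h3, Nat.floor_natCast, antidiag_card T k h hh]

lemma LP_poly {m n : ℕ} (v : Fin m → Fin n → ℤ) (T : Finset (Fin m)) :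
    T.Nonempty → ∃ p : Polynomial ℚ, p.natDegree ≤ n ∧
      ∀ k : ℕ, ((LP v T k).ncard : ℚ) = p.eval (k : ℚ) := by
  classical
  induction T using Finset.strongInduction with
  | H T ih =>
  intro hne
  by_cases hT : Indep v T
  · exact LP_poly_indep hT hne
  unfold Indep at hT
  push Not at hT
  obtain ⟨w, hw1, hw2, hw3, hw0⟩ := hT
  obtain ⟨l, hl⟩ := Function.ne_iff.1 hw0
  obtain ⟨i0, -, hi0⟩ := Finset.exists_pos_of_sum_zero_of_exists_nonzero w hw2
    ⟨l, Finset.mem_univ _, hl⟩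
  obtain ⟨j0, -, hj0⟩ := Finset.exists_pos_of_sum_zero_of_exists_nonzero (fun i => -w i)
    (by simp [hw2]) ⟨l, Finset.mem_univ _, neg_ne_zero.2 hl⟩
  set I : Finset (Fin m) := Finset.univ.filter fun i => 0 < w i with hIdef
  have hI : ∀ i, i ∈ I ↔ 0 < w i := fun i => by simp [hIdef]
  have hIT : ∀ i, i ∈ I → i ∈ T := fun i hi => by
    by_contra h
    exact ((hI i).1 hi).ne' (hw1 i h)
  have hjT : j0 ∈ T := by
    by_contra h
    have := hw1 j0 h
    simp [this] at hj0
  have hjI : j0 ∉ I := fun h => by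
    have := (hI _).1 h
    linarith
  have hex : ∀ S, ∃ p : Polynomial ℚ, S ∈ I.powerset.erase ∅ → (p.natDegree ≤ n ∧
      ∀ k : ℕ, ((LP v (T \ S) k).ncard : ℚ) = p.eval (k : ℚ)) := by
    intro S
    by_cases hS : S ∈ I.powerset.erase ∅
    · rw [Finset.mem_erase, Finset.mem_powerset] at hS
      have hss : T \ S ⊂ T := by
        refine Finset.sdiff_ssubset (fun i hi => hIT i (hS.2 hi)) (Finset.nonempty_iff_ne_empty.2 hS.1)
      obtain ⟨p, hp⟩ := ih _ hss ⟨j0, Finset.mem_sdiff.2 ⟨hjT, fun h => hjI (hS.2 h)⟩⟩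
      exact ⟨p, fun _ => hp⟩
    · exact ⟨0, fun h => absurd h hS⟩
  choose P hP using hex
  refine ⟨-∑ S ∈ I.powerset.erase ∅, Polynomial.C ((-1 : ℚ) ^ S.card) * P S, ?_, fun k => ?_⟩
  · rw [Polynomial.natDegree_neg]
    exact Polynomial.natDegree_sum_le_of_forall_le _ _ fun S hS =>
      (Polynomial.natDegree_C_mul_le _ _).trans (hP S hS).1
  · have hcount : ∀ S, ((LP v (T \ S) k).ncard : ℤ)
        = ∑ x ∈ (LP_finite v T k).toFinset, (if (WF v (T \ S) k x).Nonempty then (1 : ℤ) else 0) := by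
      intro S
      rw [Finset.sum_boole, ← Set.ncard_coe_finset]
      congr 2
      ext x
      simp only [Finset.coe_filter, Set.Finite.mem_toFinset]
      constructor
      · intro hx
        refine ⟨?_, hx⟩
        obtain ⟨c, h1, h2, h3⟩ := hx
        exact ⟨c, h1, fun i hi => h2 i (fun h => hi (Finset.mem_sdiff.1 h).1), h3⟩
      · exact fun hx => hx.2
    have hz : ∑ S ∈ I.powerset, (-1 : ℤ) ^ S.card * ((LP v (T \ S) k).ncard : ℤ) = 0 := by
      simp only [hcount, Finset.mul_sum, mul_ite, mul_one, mul_zero]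
      rw [Finset.sum_comm]
      exact Finset.sum_eq_zero fun x _ =>
        WF_alt v T k x w hw1 hw2 hw3 I hI i0 ((hI _).2 hi0)
    rw [← Finset.add_sum_erase _ _ (Finset.empty_mem_powerset I)] at hz
    simp only [Finset.card_empty, pow_zero, one_mul, Finset.sdiff_empty] at hz
    have hz' := congrArg (Int.cast : ℤ → ℚ) hz
    push_cast at hz'
    rw [Polynomial.eval_neg, Polynomial.eval_finsetSum, eq_neg_iff_add_eq_zero, ← hz']
    congr 1
    refine Finset.sum_congr rfl fun S hS => ?_
    rw [Polynomial.eval_mul, Polynomial.eval_C, (hP S hS).2 k]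

open Pointwise in
lemma LP_eq {m n : ℕ} (v : Fin m → Fin n → ℤ) (hm : 0 < m) (k : ℕ) (x : Fin n → ℤ) :
    (fun i => (x i : ℝ)) ∈ (k : ℝ) • convexHull ℝ (Set.range fun a i => (v a i : ℝ)) ↔
      x ∈ LP v Finset.univ k := by
  have hhull : convexHull ℝ (Set.range fun a i => (v a i : ℝ)) =
      (Fintype.linearCombination ℝ (fun a i => (v a i : ℝ))) '' stdSimplex ℝ (Fin m) := by
    rw [← convexHull_rangle_single_eq_stdSimplex, LinearMap.image_convexHull, ← Set.range_comp]
    congr 2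
    funext a
    simp [Fintype.linearCombination_apply_single]
  have happ : ∀ (c : Fin m → ℝ) j,
      Fintype.linearCombination ℝ (fun a i => (v a i : ℝ)) c j = ∑ i, c i * (v i j : ℝ) := by
    intro c j
    simp [Fintype.linearCombination_apply]
  rw [hhull]
  constructor
  · rintro ⟨_, ⟨c, ⟨hc0, hc1⟩, rfl⟩, he⟩
    refine ⟨fun i => k * c i, fun i => mul_nonneg (Nat.cast_nonneg _) (hc0 i), by simp, ?_, ?_⟩
    · rw [← Finset.mul_sum, hc1, mul_one]
    · intro j
      have := congrFun he j
      simp only [Pi.smul_apply, happ, smul_eq_mul] at this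
      rw [← this, Finset.mul_sum]
      exact Finset.sum_congr rfl fun i _ => by ring
  · rintro ⟨c, h1, -, h3, h4⟩
    rcases Nat.eq_zero_or_pos k with rfl | hk
    · have hc : ∀ i, c i = 0 := by
        intro i
        refine (Finset.sum_eq_zero_iff_of_nonneg (fun i _ => h1 i)).1 (by simpa using h3) i (Finset.mem_univ i)
      refine ⟨_, ⟨_, single_mem_stdSimplex ℝ (⟨0, hm⟩ : Fin m), rfl⟩, ?_⟩
      funext j
      simp [← h4 j, hc]
    · have hk' : (k : ℝ) ≠ 0 := by exact_mod_cast hk.ne'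
      refine ⟨_, ⟨fun i => (k : ℝ)⁻¹ * c i, ⟨fun i => mul_nonneg (by positivity) (h1 i), ?_⟩, rfl⟩, ?_⟩
      · rw [← Finset.mul_sum, h3, inv_mul_cancel₀ hk']
      · funext j
        simp only [Pi.smul_apply, happ, smul_eq_mul, ← h4 j, Finset.mul_sum]
        exact Finset.sum_congr rfl fun i _ => by field_simp


open Pointwise

/-- Ehrhart (1962): if `P ⊆ ℝ^n` is the convex hull of a finite nonempty set of lattice
points, then the lattice-point counting function `E_P(k) = |kP ∩ ℤ^n|` is given by a
polynomial with rational coefficients of degree at most `n`. -/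
theorem ehrhart_polynomial (n : ℕ) (hn : 1 ≤ n)
    (A : Finset (Fin n → ℤ)) (hA : A.Nonempty) :
    ∃ p : Polynomial ℚ, p.natDegree ≤ n ∧
      ∀ k : ℕ,
        ({x : Fin n → ℤ | (fun i => (x i : ℝ)) ∈
            (k : ℝ) • convexHull ℝ ((fun v : Fin n → ℤ => fun i => (v i : ℝ)) '' A)}.ncard : ℚ)
          = p.eval (k : ℚ) := by
  let v : Fin A.card → Fin n → ℤ := fun a => (A.equivFin.symm a : Fin n → ℤ)
  have hm : 0 < A.card := hA.card_pos
  have hr : (fun v : Fin n → ℤ => fun i => (v i : ℝ)) '' (A : Set (Fin n → ℤ)) =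
      Set.range fun a i => (v a i : ℝ) := by
    ext y
    constructor
    · rintro ⟨z, hz, rfl⟩
      exact ⟨A.equivFin ⟨z, hz⟩, by simp [v]⟩
    · rintro ⟨a, rfl⟩
      exact ⟨v a, (A.equivFin.symm a).2, rfl⟩
  obtain ⟨p, hp1, hp2⟩ := LP_poly v Finset.univ ⟨⟨0, hm⟩, Finset.mem_univ _⟩
  refine ⟨p, hp1, fun k => ?_⟩
  rw [← hp2 k, hr]
  congr 2
  ext x
  exact LP_eq v hm k x
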